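/- Let t be a plain term of call-by-name λFv with Γ;Δ ⊢ t : S, where Γ = x1:T1,…,xn:Tn and Δ = k1:¬U1,…,km:¬Um. Let {α1,…,αp} = ftv(S) ∪ ftv(Γ) ∪ ftv(Δ), let V̄ be a sequence of p types, and let R̄ be reducibility candidates with R_i ∈ RC(V_i) for i = 1,…,p. Let t̄ be closed terms with ⊢ t_i : T_i[ᾱ:=V̄] and Q_{RED_{T_i}(ᾱ↦R̄)}(t_i) for i = 1,…,n. Let Ē be closed contexts with ⊢ E_i : ¬U_i and RED_{U_i}(ᾱ↦R̄) ⊨ E_i for i = 1,…,m, and let E be a closed context with ⊢ E : ¬S and RED_S(ᾱ↦R̄) ⊨ E. Then norm(E[t[ᾱ:=V̄][x̄:=t̄][k̄:=⌈Ē⌉]]) holds. -/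

import Mathlib

/-!
Language `λFv`: explicitly typed System F extended with the abortive control
operator `callcc` and a `throw` construct, in de Bruijn representation
(separate de Bruijn indices for term variables, continuation variables and
type variables).
-/

namespace LambdaFv

/-- Types of System F: type variables (de Bruijn), arrow types, universal types. -/
inductive Ty : Type where
  | var : Nat → Ty
  | arrow : Ty → Ty → Ty
  | all : Ty → Ty

/-- Lifting of a renaming under a binder. -/
def liftRen (ρ : Nat → Nat) : Nat → Nat
  | 0 => 0
  | n+1 => ρ n + 1

/-- Renaming of type variables in a type. -/
def renTy (ρ : Nat → Nat) : Ty → Ty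
  | .var n => .var (ρ n)
  | .arrow a b => .arrow (renTy ρ a) (renTy ρ b)
  | .all a => .all (renTy (liftRen ρ) a)

/-- Lifting of a type substitution under a type binder. -/
def liftTySub (σ : Nat → Ty) : Nat → Ty
  | 0 => .var 0
  | n+1 => renTy Nat.succ (σ n)

/-- Simultaneous substitution of types for type variables in a type. -/
def subTy (σ : Nat → Ty) : Ty → Ty
  | .var n => σ n
  | .arrow a b => .arrow (subTy σ a) (subTy σ b)
  | .all a => .all (subTy (liftTySub σ) a)

/-- `subTy0 U S` is `S[α₀ := U]` (instantiation of the type variable 0). -/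
def subTy0 (U : Ty) (S : Ty) : Ty :=
  subTy (fun n => match n with | 0 => U | n+1 => .var n) S

/-- `subTyList Ts S` is `S[ᾱ := Ts]`: simultaneous substitution of the types
`Ts` for the free type variables of `S`. -/
def subTyList (Ts : List Ty) (S : Ty) : Ty :=
  subTy (fun n => Ts.getD n (.var n)) S

/-- `ScopedTy p S`: all free type variables of `S` are among `α₀,…,α_{p-1}`. -/
inductive ScopedTy : Nat → Ty → Prop where
  | var : ∀ {p n}, n < p → ScopedTy p (.var n)
  | arrow : ∀ {p a b}, ScopedTy p a → ScopedTy p b → ScopedTy p (.arrow a b)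
  | all : ∀ {p a}, ScopedTy (p+1) a → ScopedTy p (.all a)

/-- A closed type: no free type variables. -/
def ClosedTy (S : Ty) : Prop := ScopedTy 0 S

mutual
/-- Terms of `λFv`:
variables, `λx:S.t`, application, `Λα.t`, type application, `K k.t` (callcc),
`k ← t` (throw to a continuation variable), `⌈E⌉ ← t` (throw to a reified context). -/
inductive Tm : Type where
  | var : Nat → Tm
  | lam : Ty → Tm → Tm
  | app : Tm → Tm → Tm
  | tlam : Tm → Tm
  | tapp : Tm → Ty → Tm
  | callcc : Tm → Tm
  | throwVar : Nat → Tm → Tm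
  | throwCtx : Ctx → Tm → Tm

/-- Call-by-value evaluation contexts, represented inside-out:
`[]`, `(λx:S.t)·E`, `E t`, `E S`, `⌈E₀⌉ ← E`. -/
inductive Ctx : Type where
  | hole : Ctx
  | lamApp : Ty → Tm → Ctx → Ctx
  | app : Ctx → Tm → Ctx
  | tapp : Ctx → Ty → Ctx
  | throw : Ctx → Ctx → Ctx
end

/-- Plugging a term in a context (contexts are represented inside-out). -/
def plug : Tm → Ctx → Tm
  | t, .hole => t
  | t, .lamApp S b E => plug (.app (.lam S b) t) E
  | t, .app E u => plug (.app t u) E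
  | t, .tapp E S => plug (.tapp t S) E
  | t, .throw E0 E => plug (.throwCtx E0 t) E

/-- Values: λ-abstractions and Λ-abstractions. -/
inductive IsValue : Tm → Prop where
  | lam : ∀ {S t}, IsValue (.lam S t)
  | tlam : ∀ {t}, IsValue (.tlam t)

/-- Plain terms: terms with no subterm of the form `⌈E⌉ ← t`. -/
inductive Plain : Tm → Prop where
  | var : ∀ {n}, Plain (.var n)
  | lam : ∀ {S t}, Plain t → Plain (.lam S t)
  | app : ∀ {a b}, Plain a → Plain b → Plain (.app a b)
  | tlam : ∀ {t}, Plain t → Plain (.tlam t)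
  | tapp : ∀ {t S}, Plain t → Plain (.tapp t S)
  | callcc : ∀ {t}, Plain t → Plain (.callcc t)
  | throwVar : ∀ {k t}, Plain t → Plain (.throwVar k t)

mutual
/-- `ScTm n m p t`: the free term variables of `t` are `< n`, its free
continuation variables are `< m` and its free type variables are `< p`. -/
inductive ScTm : Nat → Nat → Nat → Tm → Prop where
  | var : ∀ {n m p x}, x < n → ScTm n m p (.var x)
  | lam : ∀ {n m p S t}, ScopedTy p S → ScTm (n+1) m p t → ScTm n m p (.lam S t)
  | app : ∀ {n m p a b}, ScTm n m p a → ScTm n m p b → ScTm n m p (.app a b)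
  | tlam : ∀ {n m p t}, ScTm n m (p+1) t → ScTm n m p (.tlam t)
  | tapp : ∀ {n m p t S}, ScTm n m p t → ScopedTy p S → ScTm n m p (.tapp t S)
  | callcc : ∀ {n m p t}, ScTm n (m+1) p t → ScTm n m p (.callcc t)
  | throwVar : ∀ {n m p k t}, k < m → ScTm n m p t → ScTm n m p (.throwVar k t)
  | throwCtx : ∀ {n m p E t}, ScCtx n m p E → ScTm n m p t → ScTm n m p (.throwCtx E t)

/-- Scoping predicate for contexts. -/
inductive ScCtx : Nat → Nat → Nat → Ctx → Prop where
  | hole : ∀ {n m p}, ScCtx n m p .hole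
  | lamApp : ∀ {n m p S t E}, ScopedTy p S → ScTm (n+1) m p t → ScCtx n m p E →
      ScCtx n m p (.lamApp S t E)
  | app : ∀ {n m p E t}, ScCtx n m p E → ScTm n m p t → ScCtx n m p (.app E t)
  | tapp : ∀ {n m p E S}, ScCtx n m p E → ScopedTy p S → ScCtx n m p (.tapp E S)
  | throw : ∀ {n m p E0 E1}, ScCtx n m p E0 → ScCtx n m p E1 → ScCtx n m p (.throw E0 E1)
end

/-- A closed term: no free variables of any kind. -/
def ClosedTm (t : Tm) : Prop := ScTm 0 0 0 t

/-- A closed context: no free variables of any kind. -/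
def ClosedCtx (E : Ctx) : Prop := ScCtx 0 0 0 E

mutual
/-- Renaming of the three kinds of variables in terms. -/
def renTm (ρx ρk ρa : Nat → Nat) : Tm → Tm
  | .var n => .var (ρx n)
  | .lam S t => .lam (renTy ρa S) (renTm (liftRen ρx) ρk ρa t)
  | .app a b => .app (renTm ρx ρk ρa a) (renTm ρx ρk ρa b)
  | .tlam t => .tlam (renTm ρx ρk (liftRen ρa) t)
  | .tapp t S => .tapp (renTm ρx ρk ρa t) (renTy ρa S)
  | .callcc t => .callcc (renTm ρx (liftRen ρk) ρa t)
  | .throwVar k t => .throwVar (ρk k) (renTm ρx ρk ρa t)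
  | .throwCtx E t => .throwCtx (renCtx ρx ρk ρa E) (renTm ρx ρk ρa t)

/-- Renaming of the three kinds of variables in contexts. -/
def renCtx (ρx ρk ρa : Nat → Nat) : Ctx → Ctx
  | .hole => .hole
  | .lamApp S t E => .lamApp (renTy ρa S) (renTm (liftRen ρx) ρk ρa t) (renCtx ρx ρk ρa E)
  | .app E t => .app (renCtx ρx ρk ρa E) (renTm ρx ρk ρa t)
  | .tapp E S => .tapp (renCtx ρx ρk ρa E) (renTy ρa S)
  | .throw E0 E => .throw (renCtx ρx ρk ρa E0) (renCtx ρx ρk ρa E)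
end

/-- An entry of a continuation substitution: either a reified context or a
continuation variable. -/
def mapKEnt (f : Ctx → Ctx) : Ctx ⊕ Nat → Ctx ⊕ Nat
  | .inl E => .inl (f E)
  | .inr n => .inr n

/-- Lifting of a term substitution under a term binder. -/
def liftSubX (σ : Nat → Tm) : Nat → Tm
  | 0 => .var 0
  | n+1 => renTm Nat.succ id id (σ n)

/-- Shifting of a term substitution under a continuation binder. -/
def shiftSubXk (σ : Nat → Tm) : Nat → Tm := fun n => renTm id Nat.succ id (σ n)

/-- Shifting of a term substitution under a type binder. -/
def shiftSubXa (σ : Nat → Tm) : Nat → Tm := fun n => renTm id id Nat.succ (σ n)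

/-- Lifting of a continuation substitution under a continuation binder. -/
def liftSubK (σ : Nat → Ctx ⊕ Nat) : Nat → Ctx ⊕ Nat
  | 0 => .inr 0
  | n+1 =>
    match σ n with
    | .inl E => .inl (renCtx id Nat.succ id E)
    | .inr m => .inr (m+1)

/-- Shifting of a continuation substitution under a term binder. -/
def shiftSubKx (σ : Nat → Ctx ⊕ Nat) : Nat → Ctx ⊕ Nat :=
  fun n => mapKEnt (renCtx Nat.succ id id) (σ n)

/-- Shifting of a continuation substitution under a type binder. -/
def shiftSubKa (σ : Nat → Ctx ⊕ Nat) : Nat → Ctx ⊕ Nat :=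
  fun n => mapKEnt (renCtx id id Nat.succ) (σ n)

mutual
/-- Simultaneous capture-avoiding substitution in terms: `σx` substitutes terms for
term variables, `σk` substitutes reified contexts for continuation variables,
`σa` substitutes types for type variables. -/
def subTm (σx : Nat → Tm) (σk : Nat → Ctx ⊕ Nat) (σa : Nat → Ty) : Tm → Tm
  | .var n => σx n
  | .lam S t => .lam (subTy σa S) (subTm (liftSubX σx) (shiftSubKx σk) σa t)
  | .app a b => .app (subTm σx σk σa a) (subTm σx σk σa b)
  | .tlam t => .tlam (subTm (shiftSubXa σx) (shiftSubKa σk) (liftTySub σa) t)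
  | .tapp t S => .tapp (subTm σx σk σa t) (subTy σa S)
  | .callcc t => .callcc (subTm (shiftSubXk σx) (liftSubK σk) σa t)
  | .throwVar k t =>
    match σk k with
    | .inl E => .throwCtx E (subTm σx σk σa t)
    | .inr m => .throwVar m (subTm σx σk σa t)
  | .throwCtx E t => .throwCtx (subCtx σx σk σa E) (subTm σx σk σa t)

/-- Simultaneous capture-avoiding substitution in contexts. -/
def subCtx (σx : Nat → Tm) (σk : Nat → Ctx ⊕ Nat) (σa : Nat → Ty) : Ctx → Ctx
  | .hole => .hole
  | .lamApp S t E => .lamApp (subTy σa S) (subTm (liftSubX σx) (shiftSubKx σk) σa t) (subCtx σx σk σa E)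
  | .app E t => .app (subCtx σx σk σa E) (subTm σx σk σa t)
  | .tapp E S => .tapp (subCtx σx σk σa E) (subTy σa S)
  | .throw E0 E => .throw (subCtx σx σk σa E0) (subCtx σx σk σa E)
end

/-- `sub0X v t` is `t[x₀ := v]`. -/
def sub0X (v : Tm) (t : Tm) : Tm :=
  subTm (fun n => match n with | 0 => v | n+1 => .var n) Sum.inr Ty.var t

/-- `sub0A S t` is `t[α₀ := S]`. -/
def sub0A (S : Ty) (t : Tm) : Tm :=
  subTm Tm.var Sum.inr (fun n => match n with | 0 => S | n+1 => .var n) t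

/-- `sub0K E t` is `t[k₀ := ⌈E⌉]`. -/
def sub0K (E : Ctx) (t : Tm) : Tm :=
  subTm Tm.var (fun n => match n with | 0 => .inl E | n+1 => .inr n) Ty.var t

/-- `msub Vs vs Es t` is the simultaneous substitution
`t[ᾱ := Vs][x̄ := vs][k̄ := ⌈Es⌉]`. -/
def msub (Vs : List Ty) (vs : List Tm) (Es : List Ctx) (t : Tm) : Tm :=
  subTm (fun n => vs.getD n (.var n))
        (fun n => match Es[n]? with | some E => .inl E | none => .inr n)
        (fun n => Vs.getD n (.var n)) t

mutual
/-- The type system of Figure 1: typing of terms, `Γ;Δ ⊢ t : S`.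
`Γ` assigns types to term variables; `Δ` assigns context types `¬S`
(represented by their hole type `S`) to continuation variables. -/
inductive HasTy : List Ty → List Ty → Tm → Ty → Prop where
  | var : ∀ {Γ Δ x S}, Γ[x]? = some S → HasTy Γ Δ (.var x) S
  | lam : ∀ {Γ Δ S T t}, HasTy (S::Γ) Δ t T → HasTy Γ Δ (.lam S t) (.arrow S T)
  | app : ∀ {Γ Δ S T t0 t1}, HasTy Γ Δ t0 (.arrow S T) → HasTy Γ Δ t1 S →
      HasTy Γ Δ (.app t0 t1) T
  | tlam : ∀ {Γ Δ t S}, HasTy (Γ.map (renTy Nat.succ)) (Δ.map (renTy Nat.succ)) t S →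
      HasTy Γ Δ (.tlam t) (.all S)
  | tapp : ∀ {Γ Δ t S T}, HasTy Γ Δ t (.all S) → HasTy Γ Δ (.tapp t T) (subTy0 T S)
  | callcc : ∀ {Γ Δ t S}, HasTy Γ (S::Δ) t S → HasTy Γ Δ (.callcc t) S
  | throwVar : ∀ {Γ Δ k t S T}, Δ[k]? = some S → HasTy Γ Δ t S →
      HasTy Γ Δ (.throwVar k t) T
  | throwCtx : ∀ {Γ Δ E t S T}, HasTyCtx Γ Δ E S → HasTy Γ Δ t S →
      HasTy Γ Δ (.throwCtx E t) T

/-- The type system of Figure 1: typing of contexts, `Γ;Δ ⊢ E : ¬S`. -/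
inductive HasTyCtx : List Ty → List Ty → Ctx → Ty → Prop where
  | hole : ∀ {Γ Δ S}, HasTyCtx Γ Δ .hole S
  | lamApp : ∀ {Γ Δ S T t E}, HasTy Γ Δ (.lam S t) (.arrow S T) → HasTyCtx Γ Δ E T →
      HasTyCtx Γ Δ (.lamApp S t E) S
  | app : ∀ {Γ Δ S T t E}, HasTy Γ Δ t S → HasTyCtx Γ Δ E T →
      HasTyCtx Γ Δ (.app E t) (.arrow S T)
  | tapp : ∀ {Γ Δ S T E}, HasTyCtx Γ Δ E (subTy0 T S) → HasTyCtx Γ Δ (.tapp E T) (.all S)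
  | throw : ∀ {Γ Δ S T E0 E1}, HasTyCtx Γ Δ E0 S → HasTyCtx Γ Δ E1 T →
      HasTyCtx Γ Δ (.throw E0 E1) S
end

/-- The call-by-value one-step reduction relation `→v` of `λFv`. -/
inductive Step : Tm → Tm → Prop where
  | beta : ∀ {S t v E}, IsValue v →
      Step (plug (.app (.lam S t) v) E) (plug (sub0X v t) E)
  | betaT : ∀ {t S E},
      Step (plug (.tapp (.tlam t) S) E) (plug (sub0A S t) E)
  | callcc : ∀ {t E},
      Step (plug (.callcc t) E) (plug (sub0K E t) E)
  | throw : ∀ {E0 E1 v}, IsValue v →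
      Step (plug (.throwCtx E0 v) E1) (plug v E0)

/-- Call-by-value evaluation: the reflexive-transitive closure of `→v`. -/
def Steps : Tm → Tm → Prop := Relation.ReflTransGen Step

/-- Redexes of `λFv` under call by value. -/
inductive IsRedex : Tm → Prop where
  | beta : ∀ {S t v}, IsValue v → IsRedex (.app (.lam S t) v)
  | betaT : ∀ {t S}, IsRedex (.tapp (.tlam t) S)
  | callcc : ∀ {t}, IsRedex (.callcc t)
  | throw : ∀ {E v}, IsValue v → IsRedex (.throwCtx E v)

/-- `Norm p`: the program `p` evaluates to a value. -/
def Norm (p : Tm) : Prop := ∃ v, IsValue v ∧ Steps p v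

/-- A reducibility candidate of type `S` is a set of closed values of type `S`. -/
def IsCand (S : Ty) (R : Set Tm) : Prop :=
  ∀ v ∈ R, IsValue v ∧ ClosedTm v ∧ HasTy [] [] v S

/-- `CtxOK R E` is the predicate `R ⊨ E`, i.e. `∀ v ∈ R, norm (E[v])`. -/
def CtxOK (R : Set Tm) (E : Ctx) : Prop := ∀ v ∈ R, Norm (plug v E)

/-- `CtxAdm A R E`: `E` is a closed context of type `¬A` with `R ⊨ E`. -/
def CtxAdm (A : Ty) (R : Set Tm) (E : Ctx) : Prop :=
  ClosedCtx E ∧ HasTyCtx [] [] E A ∧ CtxOK R E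

/-- The parametric reducibility candidate `RED_S(ᾱ ↦ R̄)` (call by value),
defined by induction on `S`.  `Ts` are the types of the candidates `Rs`. -/
def RED : Ty → List Ty → List (Set Tm) → Set Tm
  | .var i, _, Rs => Rs.getD i ∅
  | .arrow S1 S2, Ts, Rs =>
      {v0 | IsValue v0 ∧ ClosedTm v0 ∧ HasTy [] [] v0 (subTyList Ts (.arrow S1 S2)) ∧
        ∀ v1 ∈ RED S1 Ts Rs, ∀ E, CtxAdm (subTyList Ts S2) (RED S2 Ts Rs) E →
          Norm (plug (.app v0 v1) E)}
  | .all S, Ts, Rs =>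
      {v | IsValue v ∧ ClosedTm v ∧ HasTy [] [] v (subTyList Ts (.all S)) ∧
        ∀ (U : Ty) (Rc : Set Tm), IsCand U Rc →
          ∀ E, CtxAdm (subTyList (U::Ts) S) (RED S (U::Ts) (Rc::Rs)) E →
            Norm (plug (.tapp v U) E)}

end LambdaFv
namespace LambdaFv

/-- Call-by-name evaluation contexts: `E ::= [] | E t | E S`. -/
inductive IsCbnCtx : Ctx → Prop where
  | hole : IsCbnCtx .hole
  | app : ∀ {E t}, IsCbnCtx E → IsCbnCtx (.app E t)
  | tapp : ∀ {E S}, IsCbnCtx E → IsCbnCtx (.tapp E S)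

/-- The call-by-name one-step reduction relation `→n` of `λFv`. -/
inductive StepN : Tm → Tm → Prop where
  | beta : ∀ {S t0 t1 E}, IsCbnCtx E →
      StepN (plug (.app (.lam S t0) t1) E) (plug (sub0X t1 t0) E)
  | betaT : ∀ {t S E}, IsCbnCtx E →
      StepN (plug (.tapp (.tlam t) S) E) (plug (sub0A S t) E)
  | callcc : ∀ {t E}, IsCbnCtx E →
      StepN (plug (.callcc t) E) (plug (sub0K E t) E)
  | throw : ∀ {E0 E1 t}, IsCbnCtx E1 →
      StepN (plug (.throwCtx E0 t) E1) (plug t E0)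

/-- Call-by-name evaluation: the reflexive-transitive closure of `→n`. -/
def StepsN : Tm → Tm → Prop := Relation.ReflTransGen StepN

/-- `NormN p`: the program `p` evaluates to a value under call by name. -/
def NormN (p : Tm) : Prop := ∃ v, IsValue v ∧ StepsN p v

/-- Typing of call-by-name contexts (Figure 1, restricted to cbn contexts). -/
inductive HasTyCtxN : List Ty → List Ty → Ctx → Ty → Prop where
  | hole : ∀ {Γ Δ S}, HasTyCtxN Γ Δ .hole S
  | app : ∀ {Γ Δ S T t E}, HasTy Γ Δ t S → HasTyCtxN Γ Δ E T →
      HasTyCtxN Γ Δ (.app E t) (.arrow S T)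
  | tapp : ∀ {Γ Δ S T E}, HasTyCtxN Γ Δ E (subTy0 T S) →
      HasTyCtxN Γ Δ (.tapp E T) (.all S)

/-- `CtxOKN R E` is the call-by-name predicate `R ⊨ E`. -/
def CtxOKN (R : Set Tm) (E : Ctx) : Prop := ∀ v ∈ R, NormN (plug v E)

/-- `CtxAdmN A R E`: `E` is a closed call-by-name context of type `¬A` with `R ⊨ E`. -/
def CtxAdmN (A : Ty) (R : Set Tm) (E : Ctx) : Prop :=
  IsCbnCtx E ∧ ClosedCtx E ∧ HasTyCtxN [] [] E A ∧ CtxOKN R E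

/-- `QN A R t`: for all closed contexts `E` of type `¬A` with `R ⊨ E`,
`norm (E[t])` holds (`A` is the type of the candidate `R`). -/
def QN (A : Ty) (R : Set Tm) (t : Tm) : Prop :=
  ∀ E, CtxAdmN A R E → NormN (plug t E)

/-- The call-by-name parametric reducibility candidate `RED_S(ᾱ ↦ R̄)`. -/
def REDN : Ty → List Ty → List (Set Tm) → Set Tm
  | .var i, _, Rs => Rs.getD i ∅
  | .arrow S1 S2, Ts, Rs =>
      {v | IsValue v ∧ ClosedTm v ∧ HasTy [] [] v (subTyList Ts (.arrow S1 S2)) ∧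
        ∀ t, ClosedTm t → QN (subTyList Ts S1) (REDN S1 Ts Rs) t →
          QN (subTyList Ts S2) (REDN S2 Ts Rs) (.app v t)}
  | .all S, Ts, Rs =>
      {v | IsValue v ∧ ClosedTm v ∧ HasTy [] [] v (subTyList Ts (.all S)) ∧
        ∀ (U : Ty) (Rc : Set Tm), IsCand U Rc →
          ∀ E, CtxAdmN (subTyList (U::Ts) S) (REDN S (U::Ts) (Rc::Rs)) E →
            NormN (plug (.tapp v U) E)}

end LambdaFv
namespace LambdaFv

/-! ### Renaming and substitution in types -/

theorem liftRen_comp (ρ' ρ : Nat → Nat) :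
    liftRen (ρ' ∘ ρ) = liftRen ρ' ∘ liftRen ρ := by
  funext n; cases n <;> rfl

theorem renTy_renTy (ρ' ρ : Nat → Nat) (S : Ty) :
    renTy ρ' (renTy ρ S) = renTy (ρ' ∘ ρ) S := by
  induction S generalizing ρ' ρ with
  | var n => rfl
  | arrow a b iha ihb => simp [renTy, iha, ihb]
  | all a ih => simp [renTy, ih, liftRen_comp]

theorem liftRen_id : liftRen id = id := by
  funext n; cases n <;> rfl

theorem renTy_id : renTy id = id := by
  funext S
  induction S with
  | var n => rfl
  | arrow a b iha ihb => simp [renTy, iha, ihb]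
  | all a ih => simp [renTy, ih, liftRen_id]

theorem liftTySub_comp_liftRen (σ : Nat → Ty) (ρ : Nat → Nat) :
    liftTySub (σ ∘ ρ) = liftTySub σ ∘ liftRen ρ := by
  funext n; cases n <;> rfl

theorem subTy_renTy (σ : Nat → Ty) (ρ : Nat → Nat) (S : Ty) :
    subTy σ (renTy ρ S) = subTy (σ ∘ ρ) S := by
  induction S generalizing σ ρ with
  | var n => rfl
  | arrow a b iha ihb => simp [renTy, subTy, iha, ihb]
  | all a ih => simp [renTy, subTy, ih, liftTySub_comp_liftRen]

theorem liftTySub_renTy_comp (ρ : Nat → Nat) (σ : Nat → Ty) :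
    liftTySub (renTy ρ ∘ σ) = renTy (liftRen ρ) ∘ liftTySub σ := by
  funext n
  cases n with
  | zero => rfl
  | succ n => simp only [Function.comp, liftTySub, renTy_renTy]; rfl

theorem renTy_subTy (ρ : Nat → Nat) (σ : Nat → Ty) (S : Ty) :
    renTy ρ (subTy σ S) = subTy (renTy ρ ∘ σ) S := by
  induction S generalizing σ ρ with
  | var n => rfl
  | arrow a b iha ihb => simp [renTy, subTy, iha, ihb]
  | all a ih => simp [renTy, subTy, ih, liftTySub_renTy_comp]

theorem liftTySub_subTy_comp (τ σ : Nat → Ty) :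
    liftTySub (subTy τ ∘ σ) = subTy (liftTySub τ) ∘ liftTySub σ := by
  funext n
  cases n with
  | zero => rfl
  | succ n => simp only [Function.comp, liftTySub, renTy_subTy, subTy_renTy]; rfl

theorem subTy_subTy (τ σ : Nat → Ty) (S : Ty) :
    subTy τ (subTy σ S) = subTy (subTy τ ∘ σ) S := by
  induction S generalizing σ τ with
  | var n => rfl
  | arrow a b iha ihb => simp [subTy, iha, ihb]
  | all a ih => simp [subTy, ih, liftTySub_subTy_comp]

theorem liftTySub_var : liftTySub Ty.var = Ty.var := by
  funext n; cases n <;> rfl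

theorem subTy_var (S : Ty) : subTy Ty.var S = S := by
  induction S with
  | var n => rfl
  | arrow a b iha ihb => simp [subTy, iha, ihb]
  | all a ih => simp [subTy, ih, liftTySub_var]

/-! ### Renaming and substitution in terms and contexts -/

mutual
theorem renTm_renTm (ρx' ρk' ρa' ρx ρk ρa : Nat → Nat) : ∀ t : Tm,
    renTm ρx' ρk' ρa' (renTm ρx ρk ρa t) = renTm (ρx' ∘ ρx) (ρk' ∘ ρk) (ρa' ∘ ρa) t
  | .var _ => rfl
  | .lam S t => by simp [renTm, renTy_renTy, renTm_renTm _ _ _ _ _ _ t, liftRen_comp]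
  | .app a b => by simp [renTm, renTm_renTm _ _ _ _ _ _ a, renTm_renTm _ _ _ _ _ _ b]
  | .tlam t => by simp [renTm, renTm_renTm _ _ _ _ _ _ t, liftRen_comp]
  | .tapp t S => by simp [renTm, renTy_renTy, renTm_renTm _ _ _ _ _ _ t]
  | .callcc t => by simp [renTm, renTm_renTm _ _ _ _ _ _ t, liftRen_comp]
  | .throwVar k t => by simp [renTm, renTm_renTm _ _ _ _ _ _ t]
  | .throwCtx E t => by
    simp [renTm, renTm_renTm _ _ _ _ _ _ t, renCtx_renCtx _ _ _ _ _ _ E]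

theorem renCtx_renCtx (ρx' ρk' ρa' ρx ρk ρa : Nat → Nat) : ∀ E : Ctx,
    renCtx ρx' ρk' ρa' (renCtx ρx ρk ρa E) = renCtx (ρx' ∘ ρx) (ρk' ∘ ρk) (ρa' ∘ ρa) E
  | .hole => rfl
  | .lamApp S t E => by
    simp [renCtx, renTy_renTy, renTm_renTm _ _ _ _ _ _ t, renCtx_renCtx _ _ _ _ _ _ E,
      liftRen_comp]
  | .app E t => by simp [renCtx, renTm_renTm _ _ _ _ _ _ t, renCtx_renCtx _ _ _ _ _ _ E]
  | .tapp E S => by simp [renCtx, renTy_renTy, renCtx_renCtx _ _ _ _ _ _ E]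
  | .throw E0 E => by
    simp [renCtx, renCtx_renCtx _ _ _ _ _ _ E0, renCtx_renCtx _ _ _ _ _ _ E]
end

theorem liftSubX_comp_liftRen (σ : Nat → Tm) (ρ : Nat → Nat) :
    liftSubX (σ ∘ ρ) = liftSubX σ ∘ liftRen ρ := by
  funext n; cases n <;> rfl

theorem liftSubK_comp_liftRen (σ : Nat → Ctx ⊕ Nat) (ρ : Nat → Nat) :
    liftSubK (σ ∘ ρ) = liftSubK σ ∘ liftRen ρ := by
  funext n; cases n <;> rfl

theorem shiftSubXk_comp (σ : Nat → Tm) (ρ : Nat → Nat) :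
    shiftSubXk (σ ∘ ρ) = shiftSubXk σ ∘ ρ := rfl

theorem shiftSubXa_comp (σ : Nat → Tm) (ρ : Nat → Nat) :
    shiftSubXa (σ ∘ ρ) = shiftSubXa σ ∘ ρ := rfl

theorem shiftSubKx_comp (σ : Nat → Ctx ⊕ Nat) (ρ : Nat → Nat) :
    shiftSubKx (σ ∘ ρ) = shiftSubKx σ ∘ ρ := rfl

theorem shiftSubKa_comp (σ : Nat → Ctx ⊕ Nat) (ρ : Nat → Nat) :
    shiftSubKa (σ ∘ ρ) = shiftSubKa σ ∘ ρ := rfl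

mutual
theorem subTm_renTm (σx : Nat → Tm) (σk : Nat → Ctx ⊕ Nat) (σa : Nat → Ty)
    (ρx ρk ρa : Nat → Nat) : ∀ t : Tm,
    subTm σx σk σa (renTm ρx ρk ρa t) = subTm (σx ∘ ρx) (σk ∘ ρk) (σa ∘ ρa) t
  | .var _ => rfl
  | .lam S t => by
    simp [renTm, subTm, subTy_renTy, subTm_renTm _ _ _ _ _ _ t, liftSubX_comp_liftRen,
      shiftSubKx_comp]
  | .app a b => by
    simp [renTm, subTm, subTm_renTm _ _ _ _ _ _ a, subTm_renTm _ _ _ _ _ _ b]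
  | .tlam t => by
    simp [renTm, subTm, subTm_renTm _ _ _ _ _ _ t, shiftSubXa_comp, shiftSubKa_comp,
      liftTySub_comp_liftRen]
  | .tapp t S => by simp [renTm, subTm, subTy_renTy, subTm_renTm _ _ _ _ _ _ t]
  | .callcc t => by
    simp [renTm, subTm, subTm_renTm _ _ _ _ _ _ t, shiftSubXk_comp, liftSubK_comp_liftRen]
  | .throwVar k t => by simp [renTm, subTm, subTm_renTm _ _ _ _ _ _ t]
  | .throwCtx E t => by
    simp [renTm, subTm, subTm_renTm _ _ _ _ _ _ t, subCtx_renCtx _ _ _ _ _ _ E]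

theorem subCtx_renCtx (σx : Nat → Tm) (σk : Nat → Ctx ⊕ Nat) (σa : Nat → Ty)
    (ρx ρk ρa : Nat → Nat) : ∀ E : Ctx,
    subCtx σx σk σa (renCtx ρx ρk ρa E) = subCtx (σx ∘ ρx) (σk ∘ ρk) (σa ∘ ρa) E
  | .hole => rfl
  | .lamApp S t E => by
    simp [renCtx, subCtx, subTy_renTy, subTm_renTm _ _ _ _ _ _ t,
      subCtx_renCtx _ _ _ _ _ _ E, liftSubX_comp_liftRen, shiftSubKx_comp]
  | .app E t => by
    simp [renCtx, subCtx, subTm_renTm _ _ _ _ _ _ t, subCtx_renCtx _ _ _ _ _ _ E]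
  | .tapp E S => by simp [renCtx, subCtx, subTy_renTy, subCtx_renCtx _ _ _ _ _ _ E]
  | .throw E0 E => by
    simp [renCtx, subCtx, subCtx_renCtx _ _ _ _ _ _ E0, subCtx_renCtx _ _ _ _ _ _ E]
end

theorem liftSubX_renTm_comp (ρx ρk ρa : Nat → Nat) (σ : Nat → Tm) :
    liftSubX (renTm ρx ρk ρa ∘ σ) = renTm (liftRen ρx) ρk ρa ∘ liftSubX σ := by
  funext n
  cases n with
  | zero => rfl
  | succ n => simp only [Function.comp_apply, liftSubX, renTm_renTm]; rfl

theorem shiftSubXk_renTm_comp (ρx ρk ρa : Nat → Nat) (σ : Nat → Tm) :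
    shiftSubXk (renTm ρx ρk ρa ∘ σ) = renTm ρx (liftRen ρk) ρa ∘ shiftSubXk σ := by
  funext n
  simp only [Function.comp_apply, shiftSubXk, renTm_renTm]; rfl

theorem shiftSubXa_renTm_comp (ρx ρk ρa : Nat → Nat) (σ : Nat → Tm) :
    shiftSubXa (renTm ρx ρk ρa ∘ σ) = renTm ρx ρk (liftRen ρa) ∘ shiftSubXa σ := by
  funext n
  simp only [Function.comp_apply, shiftSubXa, renTm_renTm]; rfl

theorem shiftSubKx_renCtx_comp (ρx ρk ρa : Nat → Nat) (σ : Nat → Ctx ⊕ Nat) :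
    shiftSubKx (Sum.map (renCtx ρx ρk ρa) ρk ∘ σ) =
      Sum.map (renCtx (liftRen ρx) ρk ρa) ρk ∘ shiftSubKx σ := by
  funext n
  cases h : σ n with
  | inl E =>
    simp only [Function.comp_apply, shiftSubKx, h, Sum.map_inl, mapKEnt, renCtx_renCtx]; rfl
  | inr m => simp [shiftSubKx, h, mapKEnt]

theorem shiftSubKa_renCtx_comp (ρx ρk ρa : Nat → Nat) (σ : Nat → Ctx ⊕ Nat) :
    shiftSubKa (Sum.map (renCtx ρx ρk ρa) ρk ∘ σ) =
      Sum.map (renCtx ρx ρk (liftRen ρa)) ρk ∘ shiftSubKa σ := by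
  funext n
  cases h : σ n with
  | inl E =>
    simp only [Function.comp_apply, shiftSubKa, h, Sum.map_inl, mapKEnt, renCtx_renCtx]; rfl
  | inr m => simp [shiftSubKa, h, mapKEnt]

theorem liftSubK_renCtx_comp (ρx ρk ρa : Nat → Nat) (σ : Nat → Ctx ⊕ Nat) :
    liftSubK (Sum.map (renCtx ρx ρk ρa) ρk ∘ σ) =
      Sum.map (renCtx ρx (liftRen ρk) ρa) (liftRen ρk) ∘ liftSubK σ := by
  funext n
  cases n with
  | zero => rfl
  | succ n =>
    cases h : σ n with
    | inl E =>
      simp only [Function.comp_apply, liftSubK, h, Sum.map_inl, renCtx_renCtx]; rfl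
    | inr m => simp [liftSubK, h, liftRen]

mutual
theorem renTm_subTm (ρx ρk ρa : Nat → Nat) (σx : Nat → Tm) (σk : Nat → Ctx ⊕ Nat)
    (σa : Nat → Ty) : ∀ t : Tm,
    renTm ρx ρk ρa (subTm σx σk σa t) =
      subTm (renTm ρx ρk ρa ∘ σx) (Sum.map (renCtx ρx ρk ρa) ρk ∘ σk) (renTy ρa ∘ σa) t
  | .var _ => rfl
  | .lam S t => by
    simp [renTm, subTm, renTy_subTy, renTm_subTm _ _ _ _ _ _ t, liftSubX_renTm_comp,
      shiftSubKx_renCtx_comp]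
  | .app a b => by
    simp [renTm, subTm, renTm_subTm _ _ _ _ _ _ a, renTm_subTm _ _ _ _ _ _ b]
  | .tlam t => by
    simp [renTm, subTm, renTm_subTm _ _ _ _ _ _ t, shiftSubXa_renTm_comp,
      shiftSubKa_renCtx_comp, liftTySub_renTy_comp]
  | .tapp t S => by simp [renTm, subTm, renTy_subTy, renTm_subTm _ _ _ _ _ _ t]
  | .callcc t => by
    simp [renTm, subTm, renTm_subTm _ _ _ _ _ _ t, shiftSubXk_renTm_comp,
      liftSubK_renCtx_comp]
  | .throwVar k t => by
    cases h : σk k <;> simp [renTm, subTm, h, renTm_subTm _ _ _ _ _ _ t]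
  | .throwCtx E t => by
    simp [renTm, subTm, renTm_subTm _ _ _ _ _ _ t, renCtx_subCtx _ _ _ _ _ _ E]

theorem renCtx_subCtx (ρx ρk ρa : Nat → Nat) (σx : Nat → Tm) (σk : Nat → Ctx ⊕ Nat)
    (σa : Nat → Ty) : ∀ E : Ctx,
    renCtx ρx ρk ρa (subCtx σx σk σa E) =
      subCtx (renTm ρx ρk ρa ∘ σx) (Sum.map (renCtx ρx ρk ρa) ρk ∘ σk) (renTy ρa ∘ σa) E
  | .hole => rfl
  | .lamApp S t E => by
    simp [renCtx, subCtx, renTy_subTy, renTm_subTm _ _ _ _ _ _ t,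
      renCtx_subCtx _ _ _ _ _ _ E, liftSubX_renTm_comp, shiftSubKx_renCtx_comp]
  | .app E t => by
    simp [renCtx, subCtx, renTm_subTm _ _ _ _ _ _ t, renCtx_subCtx _ _ _ _ _ _ E]
  | .tapp E S => by simp [renCtx, subCtx, renTy_subTy, renCtx_subCtx _ _ _ _ _ _ E]
  | .throw E0 E => by
    simp [renCtx, subCtx, renCtx_subCtx _ _ _ _ _ _ E0, renCtx_subCtx _ _ _ _ _ _ E]
end

section Composition

variable (τx : Nat → Tm) (τk : Nat → Ctx ⊕ Nat) (τa : Nat → Ty)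

/-- The action of a substitution on an entry of a continuation substitution. -/
def subKEnt : Ctx ⊕ Nat → Ctx ⊕ Nat :=
  Sum.elim (Sum.inl ∘ subCtx τx τk τa) τk

theorem liftSubX_subTm_comp (σ : Nat → Tm) :
    liftSubX (subTm τx τk τa ∘ σ) =
      subTm (liftSubX τx) (shiftSubKx τk) τa ∘ liftSubX σ := by
  funext n
  cases n with
  | zero => rfl
  | succ n =>
    simp only [Function.comp_apply, liftSubX, renTm_subTm, subTm_renTm]
    congr 1
    · funext m; cases h : τk m <;> simp [shiftSubKx, mapKEnt, h]
    · funext m; simp [renTy_id]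

theorem shiftSubXk_subTm_comp (σ : Nat → Tm) :
    shiftSubXk (subTm τx τk τa ∘ σ) =
      subTm (shiftSubXk τx) (liftSubK τk) τa ∘ shiftSubXk σ := by
  funext n
  simp only [Function.comp_apply, shiftSubXk, renTm_subTm, subTm_renTm]
  congr 1
  · funext m; cases h : τk m <;> simp [liftSubK, h]
  · funext m; simp [renTy_id]

theorem shiftSubXa_subTm_comp (σ : Nat → Tm) :
    shiftSubXa (subTm τx τk τa ∘ σ) =
      subTm (shiftSubXa τx) (shiftSubKa τk) (liftTySub τa) ∘ shiftSubXa σ := by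
  funext n
  simp only [Function.comp_apply, shiftSubXa, renTm_subTm, subTm_renTm]
  congr 1
  funext m; cases h : τk m <;> simp [shiftSubKa, mapKEnt, h]

theorem shiftSubKx_subKEnt_comp (σ : Nat → Ctx ⊕ Nat) :
    shiftSubKx (subKEnt τx τk τa ∘ σ) =
      subKEnt (liftSubX τx) (shiftSubKx τk) τa ∘ shiftSubKx σ := by
  funext n
  cases h : σ n with
  | inl E =>
    simp only [Function.comp_apply, shiftSubKx, h, subKEnt, mapKEnt, Sum.elim_inl,
      renCtx_subCtx, subCtx_renCtx]
    congr 2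
    · funext m; cases h : τk m <;> simp [shiftSubKx, mapKEnt, h]
    · funext m; simp [renTy_id]
  | inr m => simp [shiftSubKx, h, mapKEnt, subKEnt]

theorem shiftSubKa_subKEnt_comp (σ : Nat → Ctx ⊕ Nat) :
    shiftSubKa (subKEnt τx τk τa ∘ σ) =
      subKEnt (shiftSubXa τx) (shiftSubKa τk) (liftTySub τa) ∘ shiftSubKa σ := by
  funext n
  cases h : σ n with
  | inl E =>
    simp only [Function.comp_apply, shiftSubKa, h, subKEnt, mapKEnt, Sum.elim_inl,
      renCtx_subCtx, subCtx_renCtx]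
    congr 2
    funext m; cases h : τk m <;> simp [shiftSubKa, mapKEnt, h]
  | inr m => simp [shiftSubKa, h, mapKEnt, subKEnt]

theorem liftSubK_subKEnt_comp (σ : Nat → Ctx ⊕ Nat) :
    liftSubK (subKEnt τx τk τa ∘ σ) =
      subKEnt (shiftSubXk τx) (liftSubK τk) τa ∘ liftSubK σ := by
  funext n
  cases n with
  | zero => rfl
  | succ n =>
    cases h : σ n with
    | inl E =>
      simp only [Function.comp_apply, liftSubK, h, subKEnt, Sum.elim_inl,
        renCtx_subCtx, subCtx_renCtx]
      congr 2
      · funext m; cases h : τk m <;> simp [liftSubK, h]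
      · funext m; simp [renTy_id]
    | inr m => simp [liftSubK, h, subKEnt]

end Composition

mutual
theorem subTm_subTm (τx : Nat → Tm) (τk : Nat → Ctx ⊕ Nat) (τa : Nat → Ty)
    (σx : Nat → Tm) (σk : Nat → Ctx ⊕ Nat) (σa : Nat → Ty) : ∀ t : Tm,
    subTm τx τk τa (subTm σx σk σa t) =
      subTm (subTm τx τk τa ∘ σx) (subKEnt τx τk τa ∘ σk) (subTy τa ∘ σa) t
  | .var _ => rfl
  | .lam S t => by
    simp [subTm, subTy_subTy, subTm_subTm _ _ _ _ _ _ t, liftSubX_subTm_comp,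
      shiftSubKx_subKEnt_comp]
  | .app a b => by simp [subTm, subTm_subTm _ _ _ _ _ _ a, subTm_subTm _ _ _ _ _ _ b]
  | .tlam t => by
    simp [subTm, subTm_subTm _ _ _ _ _ _ t, shiftSubXa_subTm_comp,
      shiftSubKa_subKEnt_comp, liftTySub_subTy_comp]
  | .tapp t S => by simp [subTm, subTy_subTy, subTm_subTm _ _ _ _ _ _ t]
  | .callcc t => by
    simp [subTm, subTm_subTm _ _ _ _ _ _ t, shiftSubXk_subTm_comp, liftSubK_subKEnt_comp]
  | .throwVar k t => by
    cases h : σk k <;> simp [subTm, h, subTm_subTm _ _ _ _ _ _ t, subKEnt]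
  | .throwCtx E t => by
    simp [subTm, subTm_subTm _ _ _ _ _ _ t, subCtx_subCtx _ _ _ _ _ _ E]

theorem subCtx_subCtx (τx : Nat → Tm) (τk : Nat → Ctx ⊕ Nat) (τa : Nat → Ty)
    (σx : Nat → Tm) (σk : Nat → Ctx ⊕ Nat) (σa : Nat → Ty) : ∀ E : Ctx,
    subCtx τx τk τa (subCtx σx σk σa E) =
      subCtx (subTm τx τk τa ∘ σx) (subKEnt τx τk τa ∘ σk) (subTy τa ∘ σa) E
  | .hole => rfl
  | .lamApp S t E => by
    simp [subCtx, subTy_subTy, subTm_subTm _ _ _ _ _ _ t, subCtx_subCtx _ _ _ _ _ _ E,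
      liftSubX_subTm_comp, shiftSubKx_subKEnt_comp]
  | .app E t => by
    simp [subCtx, subTm_subTm _ _ _ _ _ _ t, subCtx_subCtx _ _ _ _ _ _ E]
  | .tapp E S => by simp [subCtx, subTy_subTy, subCtx_subCtx _ _ _ _ _ _ E]
  | .throw E0 E => by
    simp [subCtx, subCtx_subCtx _ _ _ _ _ _ E0, subCtx_subCtx _ _ _ _ _ _ E]
end

theorem liftSubX_var : liftSubX Tm.var = Tm.var := by
  funext n; cases n <;> rfl

theorem liftSubK_inr : liftSubK Sum.inr = Sum.inr := by
  funext n; cases n <;> rfl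

theorem shiftSubXk_var : shiftSubXk Tm.var = Tm.var := rfl

theorem shiftSubXa_var : shiftSubXa Tm.var = Tm.var := rfl

theorem shiftSubKx_inr : shiftSubKx Sum.inr = Sum.inr := rfl

theorem shiftSubKa_inr : shiftSubKa Sum.inr = Sum.inr := rfl

mutual
theorem subTm_var : ∀ t : Tm, subTm Tm.var Sum.inr Ty.var t = t
  | .var _ => rfl
  | .lam S t => by simp [subTm, subTy_var, liftSubX_var, shiftSubKx_inr, subTm_var t]
  | .app a b => by simp [subTm, subTm_var a, subTm_var b]
  | .tlam t => by
    simp [subTm, shiftSubXa_var, shiftSubKa_inr, liftTySub_var, subTm_var t]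
  | .tapp t S => by simp [subTm, subTy_var, subTm_var t]
  | .callcc t => by simp [subTm, shiftSubXk_var, liftSubK_inr, subTm_var t]
  | .throwVar k t => by simp [subTm, subTm_var t]
  | .throwCtx E t => by simp [subTm, subTm_var t, subCtx_var E]

theorem subCtx_var : ∀ E : Ctx, subCtx Tm.var Sum.inr Ty.var E = E
  | .hole => rfl
  | .lamApp S t E => by
    simp [subCtx, subTy_var, liftSubX_var, shiftSubKx_inr, subTm_var t, subCtx_var E]
  | .app E t => by simp [subCtx, subTm_var t, subCtx_var E]
  | .tapp E S => by simp [subCtx, subTy_var, subCtx_var E]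
  | .throw E0 E => by simp [subCtx, subCtx_var E0, subCtx_var E]
end

/-- Extension of a sequence by a new head. -/
def scons {α : Type*} (a : α) (f : Nat → α) : Nat → α
  | 0 => a
  | n+1 => f n

theorem sub0X_subTm (v : Tm) (σx : Nat → Tm) (σk : Nat → Ctx ⊕ Nat) (σa : Nat → Ty)
    (t : Tm) :
    sub0X v (subTm (liftSubX σx) (shiftSubKx σk) σa t) = subTm (scons v σx) σk σa t := by
  rw [sub0X, subTm_subTm]
  congr 1
  · funext n
    cases n with
    | zero => rfl
    | succ n =>
      simp only [Function.comp_apply, liftSubX, subTm_renTm]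
      exact subTm_var _
  · funext n
    cases h : σk n with
    | inl E =>
      simp only [Function.comp_apply, shiftSubKx, h, mapKEnt, subKEnt, Sum.elim_inl,
        subCtx_renCtx]
      exact congrArg Sum.inl (subCtx_var E)
    | inr m => simp [shiftSubKx, h, mapKEnt, subKEnt]
  · funext n; exact subTy_var _

theorem sub0A_subTm (U : Ty) (σx : Nat → Tm) (σk : Nat → Ctx ⊕ Nat) (σa : Nat → Ty)
    (t : Tm) :
    sub0A U (subTm (shiftSubXa σx) (shiftSubKa σk) (liftTySub σa) t) =
      subTm σx σk (scons U σa) t := by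
  rw [sub0A, subTm_subTm]
  congr 1
  · funext n
    simp only [Function.comp_apply, shiftSubXa, subTm_renTm]
    exact subTm_var _
  · funext n
    cases h : σk n with
    | inl E =>
      simp only [Function.comp_apply, shiftSubKa, h, mapKEnt, subKEnt, Sum.elim_inl,
        subCtx_renCtx]
      exact congrArg Sum.inl (subCtx_var E)
    | inr m => simp [shiftSubKa, h, mapKEnt, subKEnt]
  · funext n
    cases n with
    | zero => rfl
    | succ n =>
      simp only [Function.comp_apply, liftTySub, subTy_renTy]
      exact subTy_var _

theorem sub0K_subTm (F : Ctx) (σx : Nat → Tm) (σk : Nat → Ctx ⊕ Nat) (σa : Nat → Ty)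
    (t : Tm) :
    sub0K F (subTm (shiftSubXk σx) (liftSubK σk) σa t) =
      subTm σx (scons (.inl F) σk) σa t := by
  rw [sub0K, subTm_subTm]
  congr 1
  · funext n
    simp only [Function.comp_apply, shiftSubXk, subTm_renTm]
    exact subTm_var _
  · funext n
    cases n with
    | zero => rfl
    | succ n =>
      cases h : σk n with
      | inl E =>
        simp only [Function.comp_apply, liftSubK, h, subKEnt, Sum.elim_inl, subCtx_renCtx,
          scons]
        exact congrArg Sum.inl (subCtx_var E)
      | inr m => simp [liftSubK, h, subKEnt, scons]
  · funext n; exact subTy_var _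

/-! ### A semantic model without closedness or typing constraints -/

/-- `Normalizing R t`: the term `t` normalizes in every call-by-name context in which all
elements of `R` normalize. -/
def Normalizing (R : Set Tm) (t : Tm) : Prop :=
  ∀ E, IsCbnCtx E → CtxOKN R E → NormN (plug t E)

/-- The interpretation of types as sets of values, for an assignment of sets of terms to
the type variables. -/
def interp : Ty → (Nat → Set Tm) → Set Tm
  | .var i, η => η i
  | .arrow S T, η =>
      {v | IsValue v ∧ ∀ t, Normalizing (interp S η) t → Normalizing (interp T η) (.app v t)}
  | .all S, η =>
      {v | IsValue v ∧ ∀ (U : Ty) (R : Set Tm), (∀ w ∈ R, IsValue w) →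
        Normalizing (interp S (scons R η)) (.tapp v U)}

theorem isValue_of_mem_interp {S : Ty} {η : Nat → Set Tm} (hη : ∀ n, ∀ v ∈ η n, IsValue v)
    {v : Tm} (hv : v ∈ interp S η) : IsValue v := by
  cases S with
  | var i => exact hη i v hv
  | arrow S T => exact hv.1
  | all S => exact hv.1

theorem interp_renTy (ρ : Nat → Nat) (S : Ty) (η : Nat → Set Tm) :
    interp (renTy ρ S) η = interp S (η ∘ ρ) := by
  induction S generalizing ρ η with
  | var i => rfl
  | arrow S T ihS ihT => simp only [renTy, interp, ihS, ihT]
  | all S ih =>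
    have h : ∀ R, scons R η ∘ liftRen ρ = scons R (η ∘ ρ) := fun R => by
      funext n; cases n <;> rfl
    simp only [renTy, interp, ih, h]

theorem interp_subTy (σ : Nat → Ty) (S : Ty) (η : Nat → Set Tm) :
    interp (subTy σ S) η = interp S (fun n => interp (σ n) η) := by
  induction S generalizing σ η with
  | var i => rfl
  | arrow S T ihS ihT => simp only [subTy, interp, ihS, ihT]
  | all S ih =>
    have h : ∀ R, (fun n => interp (liftTySub σ n) (scons R η)) =
        scons R (fun n => interp (σ n) η) := fun R => by
      funext n
      cases n with
      | zero => rfl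
      | succ n => exact interp_renTy _ _ _
    simp only [subTy, interp, ih, h]

theorem interp_subTy0 (U S : Ty) (η : Nat → Set Tm) :
    interp (subTy0 U S) η = interp S (scons (interp U η) η) := by
  rw [subTy0, interp_subTy]
  congr 1
  funext n; cases n <;> rfl

theorem NormN.of_stepN {p q : Tm} (h : StepN p q) (hq : NormN q) : NormN p :=
  let ⟨v, hv, hs⟩ := hq
  ⟨v, hv, hs.head h⟩

theorem IsValue.normN {v : Tm} (h : IsValue v) : NormN v :=
  ⟨v, h, .refl⟩

theorem Normalizing.of_mem {R : Set Tm} {v : Tm} (h : v ∈ R) : Normalizing R v :=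
  fun _ _ hE => hE v h

/-- The terms substituted for term variables normalize at their types. -/
def TmSubOK (Γ : List Ty) (η : Nat → Set Tm) (σ : Nat → Tm) : Prop :=
  ∀ (i : Nat) (T : Ty), Γ[i]? = some T → Normalizing (interp T η) (σ i)

/-- The continuation variables are replaced by contexts accepting all normalizing terms of
their types. -/
def CtxSubOK (Δ : List Ty) (η : Nat → Set Tm) (σ : Nat → Ctx ⊕ Nat) : Prop :=
  ∀ (i : Nat) (U : Ty), Δ[i]? = some U →
    ∃ E, σ i = .inl E ∧ ∀ t, Normalizing (interp U η) t → NormN (plug t E)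

theorem interp_renTy_succ (S : Ty) (R : Set Tm) (η : Nat → Set Tm) :
    interp (renTy Nat.succ S) (scons R η) = interp S η :=
  interp_renTy _ _ _

theorem TmSubOK.map_succ {Γ : List Ty} {η : Nat → Set Tm} {σ : Nat → Tm}
    (h : TmSubOK Γ η σ) (R : Set Tm) :
    TmSubOK (Γ.map (renTy Nat.succ)) (scons R η) σ := by
  intro i T hT
  rw [List.getElem?_map, Option.map_eq_some_iff] at hT
  obtain ⟨T, hT, rfl⟩ := hT
  rw [interp_renTy_succ]
  exact h i T hT

theorem CtxSubOK.map_succ {Δ : List Ty} {η : Nat → Set Tm} {σ : Nat → Ctx ⊕ Nat}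
    (h : CtxSubOK Δ η σ) (R : Set Tm) :
    CtxSubOK (Δ.map (renTy Nat.succ)) (scons R η) σ := by
  intro i U hU
  rw [List.getElem?_map, Option.map_eq_some_iff] at hU
  obtain ⟨U, hU, rfl⟩ := hU
  rw [interp_renTy_succ]
  exact h i U hU

theorem TmSubOK.scons {Γ : List Ty} {η : Nat → Set Tm} {σ : Nat → Tm} {S : Ty} {t : Tm}
    (h : TmSubOK Γ η σ) (ht : Normalizing (interp S η) t) :
    TmSubOK (S :: Γ) η (scons t σ)
  | 0, _, hT => by cases hT; exact ht
  | i+1, T, hT => h i T hT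

theorem CtxSubOK.scons {Δ : List Ty} {η : Nat → Set Tm} {σ : Nat → Ctx ⊕ Nat} {S : Ty}
    {E : Ctx} (h : CtxSubOK Δ η σ) (hE : ∀ t, Normalizing (interp S η) t → NormN (plug t E)) :
    CtxSubOK (S :: Δ) η (scons (.inl E) σ)
  | 0, _, hU => by cases hU; exact ⟨E, rfl, hE⟩
  | i+1, U, hU => h i U hU

theorem lam_mem_interp {S T : Ty} {η : Nat → Set Tm} {S' : Ty} {b : Tm}
    (h : ∀ t, Normalizing (interp S η) t → Normalizing (interp T η) (sub0X t b)) :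
    .lam S' b ∈ interp (.arrow S T) η :=
  ⟨.lam, fun t ht E hE hok => .of_stepN (.beta hE) (h t ht E hE hok)⟩

theorem Normalizing.app {S T : Ty} {η : Nat → Set Tm} {t0 t1 : Tm}
    (h0 : Normalizing (interp (.arrow S T) η) t0) (h1 : Normalizing (interp S η) t1) :
    Normalizing (interp T η) (.app t0 t1) :=
  fun E hE hok => h0 (.app E t1) (.app hE) fun _ hv => hv.2 t1 h1 E hE hok

theorem Normalizing.tapp {S U U' : Ty} {η : Nat → Set Tm} {t : Tm}
    (hη : ∀ n, ∀ v ∈ η n, IsValue v) (h : Normalizing (interp (.all S) η) t) :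
    Normalizing (interp (subTy0 U S) η) (.tapp t U') := by
  rw [interp_subTy0]
  exact fun E hE hok => h (.tapp E U') (.tapp hE) fun _ hv =>
    hv.2 U' (interp U η) (fun _ => isValue_of_mem_interp hη) E hE hok

mutual
theorem HasTy.normalizing {Γ Δ : List Ty} {t : Tm} {S : Ty} {η : Nat → Set Tm}
    {σx : Nat → Tm} {σk : Nat → Ctx ⊕ Nat} {σa : Nat → Ty}
    (hη : ∀ n, ∀ v ∈ η n, IsValue v) (hx : TmSubOK Γ η σx) (hk : CtxSubOK Δ η σk) :
    HasTy Γ Δ t S → Normalizing (interp S η) (subTm σx σk σa t)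
  | .var h => hx _ _ h
  | .lam h => .of_mem <| lam_mem_interp fun t ht => by
      rw [sub0X_subTm]
      exact h.normalizing hη (hx.scons ht) hk
  | .app h0 h1 => (h0.normalizing hη hx hk).app (h1.normalizing hη hx hk)
  | .tlam h => .of_mem ⟨.tlam, fun U R hR E hE hok => .of_stepN (.betaT hE) <| by
      rw [sub0A_subTm]
      refine h.normalizing ?_ (hx.map_succ R) (hk.map_succ R) E hE hok
      rintro (_ | n)
      exacts [hR, hη n]⟩
  | .tapp h => (h.normalizing hη hx hk).tapp hη
  | .callcc h => fun E hE hok => .of_stepN (.callcc hE) <| by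
      rw [sub0K_subTm]
      exact h.normalizing hη hx (hk.scons fun t ht => ht E hE hok) E hE hok
  | .throwVar hU h => by
      obtain ⟨F, hF, hFok⟩ := hk _ _ hU
      rw [subTm, hF]
      exact fun E hE _ => .of_stepN (.throw hE) (hFok _ (h.normalizing hη hx hk))
  | .throwCtx hF h => fun E hE _ =>
      .of_stepN (.throw hE) (hF.normN_plug hη hx hk _ (h.normalizing hη hx hk))

theorem HasTyCtx.normN_plug {Γ Δ : List Ty} {E : Ctx} {S : Ty} {η : Nat → Set Tm}
    {σx : Nat → Tm} {σk : Nat → Ctx ⊕ Nat} {σa : Nat → Ty}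
    (hη : ∀ n, ∀ v ∈ η n, IsValue v) (hx : TmSubOK Γ η σx) (hk : CtxSubOK Δ η σk) :
    HasTyCtx Γ Δ E S →
      ∀ t, Normalizing (interp S η) t → NormN (plug t (subCtx σx σk σa E))
  | .hole => fun _ ht => ht .hole .hole fun _ hv => (isValue_of_mem_interp hη hv).normN
  | .lamApp hl hE => fun _ ht =>
      hE.normN_plug hη hx hk _ ((hl.normalizing hη hx hk).app ht)
  | .app hu hE => fun _ ht => hE.normN_plug hη hx hk _ (ht.app (hu.normalizing hη hx hk))
  | .tapp hE => fun _ ht => hE.normN_plug hη hx hk _ (ht.tapp hη)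
  | .throw hE0 hE1 => fun t ht => hE1.normN_plug hη hx hk _ fun _ hF _ =>
      .of_stepN (.throw hF) (hE0.normN_plug hη hx hk t ht)
end

theorem HasTyCtxN.hasTyCtx {Γ Δ : List Ty} {E : Ctx} {S : Ty} (h : HasTyCtxN Γ Δ E S) :
    HasTyCtx Γ Δ E S := by
  induction h with
  | hole => exact .hole
  | app ht _ ih => exact .app ht ih
  | tapp _ ih => exact .tapp ih

theorem HasTy.normalizing_of_nil {t : Tm} {S : Ty} {η : Nat → Set Tm}
    (hη : ∀ n, ∀ v ∈ η n, IsValue v) (h : HasTy [] [] t S) : Normalizing (interp S η) t := by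
  rw [← subTm_var t]
  exact h.normalizing hη (fun _ _ h => by simp at h) (fun _ _ h => by simp at h)

theorem HasTyCtx.normN_plug_of_nil {E : Ctx} {S : Ty} {η : Nat → Set Tm}
    (hη : ∀ n, ∀ v ∈ η n, IsValue v) (h : HasTyCtx [] [] E S) (t : Tm)
    (ht : Normalizing (interp S η) t) : NormN (plug t E) := by
  rw [← subCtx_var E]
  exact h.normN_plug hη (fun _ _ h => by simp at h) (fun _ _ h => by simp at h) t ht

/-- **Main lemma for call-by-name `λFv`** (Lemma 4).
Let `t` be a plain term with `Γ;Δ ⊢ t : S` where `Γ = x₁:T₁,…,xₙ:Tₙ` and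
`Δ = k₁:¬U₁,…,k_m:¬U_m`; let all free type variables of `S`, `Γ`, `Δ` be
among `α₁,…,α_p` (de Bruijn: `< Vs.length`); let `V̄` be `p` types and `R̄`
reducibility candidates with `Rᵢ ∈ RC(Vᵢ)`; let `t̄` be closed terms with
`⊢ tᵢ : Tᵢ[ᾱ:=V̄]` and `Q_{RED_{Tᵢ}(ᾱ↦R̄)}(tᵢ)`; let `Ē` be closed
call-by-name contexts with `⊢ Eᵢ : ¬Uᵢ` and `RED_{Uᵢ}(ᾱ↦R̄) ⊨ Eᵢ`; and let
`E` be a closed call-by-name context with `⊢ E : ¬S` and `RED_S(ᾱ↦R̄) ⊨ E`.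
Then `norm (E[t[ᾱ:=V̄][x̄:=t̄][k̄:=Ē]])` holds under call by name. -/
theorem main_lemma_cbn
    (Γ Δ : List Ty) (t : Tm) (S : Ty)
    (Vs : List Ty) (Rs : List (Set Tm)) (ts : List Tm) (Es : List Ctx) (E : Ctx)
    (hplain : Plain t)
    (hty : HasTy Γ Δ t S)
    (hscS : ScopedTy Vs.length S)
    (hscΓ : ∀ T ∈ Γ, ScopedTy Vs.length T)
    (hscΔ : ∀ U ∈ Δ, ScopedTy Vs.length U)
    (hlenR : Vs.length = Rs.length)
    (hcand : ∀ i < Vs.length, IsCand (Vs.getD i (.var 0)) (Rs.getD i ∅))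
    (hlent : ts.length = Γ.length)
    (hterms : ∀ i < Γ.length,
      ClosedTm (ts.getD i (.var 0)) ∧
      HasTy [] [] (ts.getD i (.var 0)) (subTyList Vs (Γ.getD i (.var 0))) ∧
      QN (subTyList Vs (Γ.getD i (.var 0))) (REDN (Γ.getD i (.var 0)) Vs Rs)
        (ts.getD i (.var 0)))
    (hlenE : Es.length = Δ.length)
    (hctxs : ∀ i < Δ.length,
      IsCbnCtx (Es.getD i .hole) ∧ ClosedCtx (Es.getD i .hole) ∧
      HasTyCtxN [] [] (Es.getD i .hole) (Δ.getD i (.var 0)) ∧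
      CtxOKN (REDN (Δ.getD i (.var 0)) Vs Rs) (Es.getD i .hole))
    (hE : IsCbnCtx E ∧ ClosedCtx E ∧ HasTyCtxN [] [] E S ∧ CtxOKN (REDN S Vs Rs) E) :
    NormN (plug (msub Vs ts Es t) E) := by
  let η : Nat → Set Tm := fun n => interp (Vs.getD n (.var n)) (fun _ => ∅)
  have hη : ∀ n, ∀ v ∈ η n, IsValue v := fun n v =>
    isValue_of_mem_interp fun _ _ h => h.elim
  refine hE.2.2.1.hasTyCtx.normN_plug_of_nil hη _ (hty.normalizing hη ?_ ?_)
  · intro i T hT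
    obtain ⟨hi, rfl⟩ := List.getElem?_eq_some_iff.mp hT
    have hti := (hterms i hi).2.1.normalizing_of_nil (η := fun _ => ∅) fun _ _ h => h.elim
    rw [subTyList, interp_subTy] at hti
    simpa [η, List.getD_eq_getElem?_getD, hi, hlent] using hti
  · intro i U hU
    obtain ⟨hi, rfl⟩ := List.getElem?_eq_some_iff.mp hU
    have hEi := (hctxs i hi).2.2.1.hasTyCtx.normN_plug_of_nil hη
    have hi' : i < Es.length := hlenE ▸ hi
    simp only [List.getD_eq_getElem?_getD, List.getElem?_eq_getElem, hi, hi',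
      Option.getD_some] at hEi
    exact ⟨Es[i], by simp [hi'], hEi⟩

end LambdaFv
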